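/- Let θ ≥ 2 be an integer and let α = (α_1,…,α_r) and β = (β_1,…,β_m) be tuples of positive integers with β_m ≥ 2 (when m ≥ 1). Then Σ_{k=0}^{m} (-1)^k · ζ⋆(β_{k+1},…,β_m) · Z_U((β_k, β_{k-1},…,β_1, θ); α) = ζ⋆(α_1,…,α_r, θ, β_1,…,β_m). -/

import Mathlib

open scoped BigOperators

/-- Multiple zeta value `ζ(α₁,…,α_r) = Σ_{1 ≤ k₁ < ⋯ < k_r} k₁^{-α₁} ⋯ k_r^{-α_r}`;
`mzv [] = 1`. -/
noncomputable def mzv (α : List ℕ) : ℝ :=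
  ∑' f : {f : Fin α.length → ℕ+ // StrictMono f},
    ∏ i : Fin α.length, ((f.1 i : ℝ) ^ (α.get i))⁻¹

/-- Multiple zeta-star value `ζ⋆(α₁,…,α_r) = Σ_{1 ≤ k₁ ≤ ⋯ ≤ k_r} k₁^{-α₁} ⋯ k_r^{-α_r}`;
`mzvStar [] = 1`. -/
noncomputable def mzvStar (α : List ℕ) : ℝ :=
  ∑' f : {f : Fin α.length → ℕ+ // Monotone f},
    ∏ i : Fin α.length, ((f.1 i : ℝ) ^ (α.get i))⁻¹

/-- `Z_U(α;β) = Σ_{1≤k₁<⋯<k_r} k₁^{-α₁}⋯k_r^{-α_r} Σ_{1≤ℓ₁≤⋯≤ℓ_m≤k_r} ℓ₁^{-β₁}⋯ℓ_m^{-β_m}`. -/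
noncomputable def ZU (α β : List ℕ) : ℝ :=
  ∑' p : {p : (Fin α.length → ℕ+) × (Fin β.length → ℕ+) //
      StrictMono p.1 ∧ Monotone p.2 ∧
      ∀ j : Fin β.length, (j : ℕ) = β.length - 1 →
        ∀ i : Fin α.length, (i : ℕ) = α.length - 1 → p.2 j ≤ p.1 i},
    (∏ i : Fin α.length, ((p.1.1 i : ℝ) ^ (α.get i))⁻¹) *
      ∏ j : Fin β.length, ((p.1.2 j : ℝ) ^ (β.get j))⁻¹

/-- `Z_L(α;β) = Σ_{1≤k₁<⋯<k_r} k₁^{-α₁}⋯k_r^{-α_r} Σ_{k₁≤ℓ₁≤⋯≤ℓ_m} ℓ₁^{-β₁}⋯ℓ_m^{-β_m}`. -/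
noncomputable def ZL (α β : List ℕ) : ℝ :=
  ∑' p : {p : (Fin α.length → ℕ+) × (Fin β.length → ℕ+) //
      StrictMono p.1 ∧ Monotone p.2 ∧
      ∀ i : Fin α.length, (i : ℕ) = 0 →
        ∀ j : Fin β.length, (j : ℕ) = 0 → p.1 i ≤ p.2 j},
    (∏ i : Fin α.length, ((p.1.1 i : ℝ) ^ (α.get i))⁻¹) *
      ∏ j : Fin β.length, ((p.1.2 j : ℝ) ^ (β.get j))⁻¹

/-- `Z_B(α;β) = Σ_{1≤k₁<⋯<k_r} k₁^{-α₁}⋯k_r^{-α_r} Σ_{k₁≤ℓ₁≤⋯≤ℓ_m≤k_r} ℓ₁^{-β₁}⋯ℓ_m^{-β_m}`. -/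
noncomputable def ZB (α β : List ℕ) : ℝ :=
  ∑' p : {p : (Fin α.length → ℕ+) × (Fin β.length → ℕ+) //
      StrictMono p.1 ∧ Monotone p.2 ∧
      (∀ i : Fin α.length, (i : ℕ) = 0 →
        ∀ j : Fin β.length, (j : ℕ) = 0 → p.1 i ≤ p.2 j) ∧
      ∀ j : Fin β.length, (j : ℕ) = β.length - 1 →
        ∀ i : Fin α.length, (i : ℕ) = α.length - 1 → p.2 j ≤ p.1 i},
    (∏ i : Fin α.length, ((p.1.1 i : ℝ) ^ (α.get i))⁻¹) *
      ∏ j : Fin β.length, ((p.1.2 j : ℝ) ^ (β.get j))⁻¹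

open scoped ENNReal


/-- The weight `k ^ (-b)` as an extended nonnegative real. -/
noncomputable def zetaWeight (b : ℕ) (k : ℕ+) : ℝ≥0∞ := (((k : ℕ) : ℝ≥0∞) ^ b)⁻¹

open Classical in
/-- The sum of `∏ kᵢ ^ (-lᵢ)` over all tuples `k` such that `m, k₁, …, k_r` is an `R`-chain. -/
noncomputable def chainSum (R : ℕ+ → ℕ+ → Prop) (l : List ℕ) (m : ℕ+) : ℝ≥0∞ :=
  ∑' f : Fin l.length → ℕ+,
    if (∀ i, R m (f i)) ∧ ∀ i j, i < j → R (f i) (f j) then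
      ∏ i, zetaWeight (l.get i) (f i) else 0

lemma zetaWeight_ne_top (b : ℕ) (k : ℕ+) : zetaWeight b k ≠ ⊤ := by
  simp [zetaWeight]

lemma toReal_zetaWeight (b : ℕ) (k : ℕ+) :
    (zetaWeight b k).toReal = ((k : ℝ) ^ b)⁻¹ := by
  simp [zetaWeight]

lemma chainSum_nil (R : ℕ+ → ℕ+ → Prop) (m : ℕ+) : chainSum R [] m = 1 := by
  unfold chainSum
  rw [tsum_eq_single (fun i => i.elim0)]
  · simp
  · intro f hf
    exact absurd (Subsingleton.elim (α := Fin 0 → ℕ+) _ _) hf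

lemma tsum_fin_cons {n : ℕ} (F : (Fin (n + 1) → ℕ+) → ℝ≥0∞) :
    ∑' f, F f = ∑' k : ℕ+, ∑' g : Fin n → ℕ+, F (Fin.cons k g) := by
  rw [← (Fin.consEquiv (fun _ : Fin (n + 1) => ℕ+)).tsum_eq, ENNReal.tsum_prod']
  rfl

open Classical in
lemma chainSum_cons (R : ℕ+ → ℕ+ → Prop) [IsTrans ℕ+ R] (b : ℕ) (l : List ℕ) (m : ℕ+) :
    chainSum R (b :: l) m =
      ∑' k : ℕ+, if R m k then zetaWeight b k * chainSum R l k else 0 := by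
  unfold chainSum
  refine (tsum_fin_cons (n := l.length) _).trans (tsum_congr fun k => ?_)
  split_ifs with hk
  · rw [← ENNReal.tsum_mul_left]
    refine tsum_congr fun g => ?_
    rw [mul_ite, mul_zero]
    refine if_congr ?_ ?_ rfl
    · constructor
      · rintro ⟨h1, h2⟩
        exact ⟨fun i => h2 0 i.succ (Fin.succ_pos i),
          fun i j hij => h2 i.succ j.succ (Fin.succ_lt_succ_iff.2 hij)⟩
      · rintro ⟨h1, h2⟩
        refine ⟨fun i => ?_, fun i j hij => ?_⟩
        · refine Fin.cases hk (fun i => ?_) i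
          exact _root_.trans hk (h1 i)
        · induction j using Fin.cases with
          | zero => exact absurd hij (Fin.not_lt_zero i)
          | succ j =>
            induction i using Fin.cases with
            | zero => exact h1 j
            | succ i => exact h2 i j (Fin.succ_lt_succ_iff.1 hij)
    · exact Fin.prod_univ_succ (n := l.length) _
  · refine ENNReal.tsum_eq_zero.2 fun g => if_neg fun h => hk (h.1 0)

lemma chainSum_mono_rel {R R' : ℕ+ → ℕ+ → Prop} (h : ∀ a b, R a b → R' a b)
    (l : List ℕ) (m : ℕ+) : chainSum R l m ≤ chainSum R' l m := by
  classical
  refine ENNReal.tsum_le_tsum fun f => ?_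
  split_ifs with h1 h2
  · exact le_rfl
  · exact absurd ⟨fun i => h _ _ (h1.1 i), fun i j hij => h _ _ (h1.2 i j hij)⟩ h2
  · exact zero_le
  · exact le_rfl

lemma chainSum_le_antitone (l : List ℕ) : Antitone (chainSum (· ≤ ·) l) := by
  classical
  intro m n hmn
  refine ENNReal.tsum_le_tsum fun f => ?_
  split_ifs with h1 h2
  · exact le_rfl
  · exact absurd ⟨fun i => hmn.trans (h1.1 i), h1.2⟩ h2
  · exact zero_le
  · exact le_rfl

lemma tsum_subtype_eq_tsum_ite {X : Type*} (P : X → Prop) [DecidablePred P] (F : X → ℝ) :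
    ∑' x : {x // P x}, F x = ∑' x, if P x then F x else 0 :=
  (tsum_subtype {x | P x} F).trans (tsum_congr fun _ => by simp [Set.indicator_apply])

lemma mzvStar_eq_toReal (l : List ℕ) : mzvStar l = (chainSum (· ≤ ·) l 1).toReal := by
  classical
  unfold mzvStar chainSum
  rw [ENNReal.tsum_toReal_eq]
  · refine (tsum_subtype_eq_tsum_ite Monotone
      (fun f : Fin l.length → ℕ+ => ∏ i, ((f i : ℝ) ^ (l.get i))⁻¹)).trans
      (tsum_congr fun f => ?_)
    rw [apply_ite ENNReal.toReal, ENNReal.toReal_prod]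
    simp only [toReal_zetaWeight, ENNReal.toReal_zero]
    by_cases h : Monotone f
    · rw [if_pos h, if_pos ⟨fun i => one_le, fun i j hij => h hij.le⟩]
    · rw [if_neg h, if_neg fun h' => h (monotone_iff_forall_lt.2 fun i j hij => h'.2 i j hij)]
  · intro f
    split_ifs
    · exact ENNReal.prod_ne_top fun i _ => zetaWeight_ne_top _ _
    · simp

lemma chainSum_reverse_append (ρ : List ℕ) (θ : ℕ) (β : List ℕ) :
    chainSum (· ≤ ·) (ρ.reverse ++ θ :: β) 1 =
      ∑' n : ℕ+, zetaWeight θ n * chainSum (· ≥ ·) ρ n * chainSum (· ≤ ·) β n := by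
  classical
  induction ρ generalizing θ β with
  | nil => simp [chainSum_cons, chainSum_nil]
  | cons a ρ ih =>
    rw [List.reverse_cons, List.append_assoc, List.singleton_append, ih]
    simp only [chainSum_cons, ← ENNReal.tsum_mul_left, ← ENNReal.tsum_mul_right]
    rw [ENNReal.tsum_comm]
    refine tsum_congr fun n => tsum_congr fun k => ?_
    by_cases h : k ≤ n
    · simp only [h, ge_iff_le, if_true]; ring
    · simp [h]

lemma tsum_rpow_ne_top {s : ℝ} (hs : 1 < s) :
    ∑' k : ℕ+, ((k : ℕ) : ℝ≥0∞) ^ (-s) ≠ ⊤ := by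
  have h : Summable fun k : ℕ+ => ((k : ℕ) : ℝ) ^ (-s) :=
    (Real.summable_nat_rpow.2 (by linarith)).comp_injective PNat.coe_injective
  convert h.tsum_ofReal_ne_top using 3 with k
  rw [← ENNReal.ofReal_rpow_of_pos (by exact_mod_cast k.pos), ENNReal.ofReal_natCast]

lemma zetaWeight_le {b : ℕ} {c : ℝ} (h : c ≤ b) (k : ℕ+) :
    zetaWeight b k ≤ ((k : ℕ) : ℝ≥0∞) ^ (-c) := by
  rw [zetaWeight, ← ENNReal.rpow_natCast, ← ENNReal.rpow_neg]
  exact ENNReal.rpow_le_rpow_of_exponent_le (by exact_mod_cast Nat.succ_le_of_lt k.pos) (by linarith)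

lemma natCast_rpow_add (k : ℕ+) (s t : ℝ) :
    ((k : ℕ) : ℝ≥0∞) ^ (s + t) = ((k : ℕ) : ℝ≥0∞) ^ s * ((k : ℕ) : ℝ≥0∞) ^ t :=
  ENNReal.rpow_add _ _ (by simp) (by simp)

lemma exists_chainSum_ge_le (ρ : List ℕ) (hρ : ∀ x ∈ ρ, 0 < x) {s : ℝ} (hs : 0 < s) :
    ∃ C : ℝ≥0∞, C ≠ ⊤ ∧ ∀ n : ℕ+, chainSum (· ≥ ·) ρ n ≤ C * ((n : ℕ) : ℝ≥0∞) ^ s := by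
  classical
  induction ρ generalizing s with
  | nil =>
    refine ⟨1, by simp, fun n => ?_⟩
    rw [chainSum_nil, one_mul]
    exact ENNReal.one_le_rpow (by exact_mod_cast Nat.succ_le_of_lt n.pos) hs
  | cons a ρ ih =>
    obtain ⟨C, hC, h⟩ := ih (fun x hx => hρ x (List.mem_cons_of_mem _ hx)) (half_pos hs)
    refine ⟨C * ∑' k : ℕ+, ((k : ℕ) : ℝ≥0∞) ^ (-(1 + s / 2)),
      ENNReal.mul_ne_top hC (tsum_rpow_ne_top (by linarith)), fun n => ?_⟩
    rw [chainSum_cons, ← ENNReal.tsum_mul_left, ← ENNReal.tsum_mul_right]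
    refine ENNReal.tsum_le_tsum fun k => ?_
    split_ifs with hk
    · have ha : (1 : ℝ) ≤ a := by exact_mod_cast hρ a (by simp)
      have hk' : ((k : ℕ) : ℝ≥0∞) ^ s ≤ ((n : ℕ) : ℝ≥0∞) ^ s :=
        ENNReal.rpow_le_rpow (by exact_mod_cast hk) hs.le
      calc zetaWeight a k * chainSum (· ≥ ·) ρ k
          ≤ ((k : ℕ) : ℝ≥0∞) ^ (-1 : ℝ) * (C * ((k : ℕ) : ℝ≥0∞) ^ (s / 2)) :=
            mul_le_mul' (zetaWeight_le ha k) (h k)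
        _ = C * ((k : ℕ) : ℝ≥0∞) ^ (-(1 + s / 2)) * ((k : ℕ) : ℝ≥0∞) ^ s := by
            rw [mul_left_comm, mul_assoc, ← natCast_rpow_add, ← natCast_rpow_add]
            ring_nf
        _ ≤ _ := by gcongr
    · exact zero_le

lemma tsum_zetaWeight_mul_ne_top {θ : ℕ} (hθ : 2 ≤ θ) {ρ l : List ℕ}
    (hρ : ∀ x ∈ ρ, 0 < x) (hl : ∀ x ∈ l, 0 < x) :
    ∑' n : ℕ+, zetaWeight θ n * chainSum (· > ·) l n * chainSum (· ≥ ·) ρ n ≠ ⊤ := by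
  obtain ⟨C, hC, h⟩ := exists_chainSum_ge_le ρ hρ (s := 1 / 4) (by norm_num)
  obtain ⟨D, hD, h'⟩ := exists_chainSum_ge_le l hl (s := 1 / 4) (by norm_num)
  have hfin : C * D * ∑' k : ℕ+, ((k : ℕ) : ℝ≥0∞) ^ (-(3 / 2 : ℝ)) ≠ ⊤ :=
    ENNReal.mul_ne_top (ENNReal.mul_ne_top hC hD) (tsum_rpow_ne_top (by norm_num))
  refine ne_top_of_le_ne_top hfin ?_
  rw [← ENNReal.tsum_mul_left]
  refine ENNReal.tsum_le_tsum fun n => ?_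
  have hθ' : (2 : ℝ) ≤ θ := by exact_mod_cast hθ
  calc zetaWeight θ n * chainSum (· > ·) l n * chainSum (· ≥ ·) ρ n
      ≤ ((n : ℕ) : ℝ≥0∞) ^ (-2 : ℝ) * (D * ((n : ℕ) : ℝ≥0∞) ^ (1 / 4 : ℝ)) *
          (C * ((n : ℕ) : ℝ≥0∞) ^ (1 / 4 : ℝ)) :=
        mul_le_mul' (mul_le_mul' (zetaWeight_le hθ' n)
          ((chainSum_mono_rel (fun _ _ hab => le_of_lt hab) l n).trans (h' n))) (h n)
    _ = C * D * (((n : ℕ) : ℝ≥0∞) ^ (-2 : ℝ) * ((n : ℕ) : ℝ≥0∞) ^ (1 / 4 : ℝ) *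
          ((n : ℕ) : ℝ≥0∞) ^ (1 / 4 : ℝ)) := by ring
    _ = _ := by
        rw [← natCast_rpow_add, ← natCast_rpow_add]
        norm_num

lemma chainSum_ge_ne_top (ρ : List ℕ) (hρ : ∀ x ∈ ρ, 0 < x) (n : ℕ+) :
    chainSum (· ≥ ·) ρ n ≠ ⊤ := by
  obtain ⟨C, hC, h⟩ := exists_chainSum_ge_le ρ hρ one_pos
  exact ne_top_of_le_ne_top (ENNReal.mul_ne_top hC (by simp)) (h n)

lemma chainSum_gt_ne_top (l : List ℕ) (hl : ∀ x ∈ l, 0 < x) (n : ℕ+) :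
    chainSum (· > ·) l n ≠ ⊤ :=
  ne_top_of_le_ne_top (chainSum_ge_ne_top l hl n)
    (chainSum_mono_rel (fun _ _ hab => le_of_lt hab) l n)

lemma chainSum_le_ne_top (β : List ℕ) (hβpos : ∀ x ∈ β, 0 < x)
    (hβ : ∀ h : β ≠ [], 2 ≤ β.getLast h) (n : ℕ+) : chainSum (· ≤ ·) β n ≠ ⊤ := by
  refine ne_top_of_le_ne_top ?_ (chainSum_le_antitone β one_le)
  induction β using List.reverseRecOn with
  | nil => simp [chainSum_nil]
  | append_singleton l b =>
    have h := chainSum_reverse_append l.reverse b []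
    rw [List.reverse_reverse] at h
    rw [h]
    have hfin := tsum_zetaWeight_mul_ne_top (θ := b) (ρ := l.reverse) (l := [])
      (by simpa using hβ (by simp)) (fun x hx => hβpos x (by simp at hx; simp [hx])) (by simp)
    simpa [chainSum_nil] using hfin

open Classical in
lemma toReal_chainSum_gt_cons (b : ℕ) (l : List ℕ) (hl : ∀ x ∈ l, 0 < x) (n : ℕ+) :
    (chainSum (· > ·) (b :: l) n).toReal =
      ∑ k ∈ Finset.Iio n, (zetaWeight b k).toReal * (chainSum (· > ·) l k).toReal := by
  rw [chainSum_cons, tsum_eq_sum (s := Finset.Iio n), ENNReal.toReal_sum]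
  · refine Finset.sum_congr rfl fun k hk => ?_
    rw [if_pos (Finset.mem_Iio.1 hk), ENNReal.toReal_mul]
  · intro k hk
    rw [if_pos (Finset.mem_Iio.1 hk)]
    exact ENNReal.mul_ne_top (zetaWeight_ne_top _ _) (chainSum_gt_ne_top l hl k)
  · intro k hk
    exact if_neg fun h => hk (Finset.mem_Iio.2 h)

lemma toReal_chainSum_le_cons (b : ℕ) (β : List ℕ) (h : ∀ k, chainSum (· ≤ ·) β k ≠ ⊤)
    (h' : chainSum (· ≤ ·) (b :: β) 1 ≠ ⊤) (n : ℕ+) :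
    (chainSum (· ≤ ·) (b :: β) n).toReal = (chainSum (· ≤ ·) (b :: β) 1).toReal -
      ∑ k ∈ Finset.Iio n, (zetaWeight b k).toReal * (chainSum (· ≤ ·) β k).toReal := by
  classical
  have hsplit : chainSum (· ≤ ·) (b :: β) 1 = chainSum (· ≤ ·) (b :: β) n +
      ∑ k ∈ Finset.Iio n, zetaWeight b k * chainSum (· ≤ ·) β k := by
    have hsum : ∑ k ∈ Finset.Iio n, zetaWeight b k * chainSum (· ≤ ·) β k =
        ∑' k : ℕ+, if k < n then zetaWeight b k * chainSum (· ≤ ·) β k else 0 := by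
      rw [tsum_eq_sum (s := Finset.Iio n)]
      · exact Finset.sum_congr rfl fun k hk => (if_pos (Finset.mem_Iio.1 hk)).symm
      · exact fun k hk => if_neg fun h => hk (Finset.mem_Iio.2 h)
    rw [hsum, chainSum_cons, chainSum_cons, ← ENNReal.tsum_add]
    refine tsum_congr fun k => ?_
    rcases lt_or_ge k n with hk | hk
    · simp [hk, hk.not_ge]
    · simp [hk, hk.not_gt]
  have hterm : ∀ k ∈ Finset.Iio n, zetaWeight b k * chainSum (· ≤ ·) β k ≠ ⊤ :=
    fun k _ => ENNReal.mul_ne_top (zetaWeight_ne_top _ _) (h k)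
  rw [hsplit, ENNReal.toReal_add (ne_top_of_le_ne_top h' (hsplit ▸ le_self_add))
    (ENNReal.sum_ne_top.2 hterm), ENNReal.toReal_sum hterm]
  simp only [ENNReal.toReal_mul]
  ring

/-- The complementation identity expressing the sum over `n ≤ k₁ ≤ ⋯ ≤ k_m` through unrestricted
sums and sums over descending tuples below `n`. -/
lemma sum_neg_one_pow_chainSum (β : List ℕ) (hβpos : ∀ x ∈ β, 0 < x)
    (hβ : ∀ h : β ≠ [], 2 ≤ β.getLast h) (n : ℕ+) :
    ∑ k ∈ Finset.range (β.length + 1), (-1 : ℝ) ^ k *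
      (chainSum (· ≤ ·) (β.drop k) 1).toReal * (chainSum (· > ·) (β.take k) n).toReal =
      (chainSum (· ≤ ·) β n).toReal := by
  induction β generalizing n with
  | nil => simp [chainSum_nil]
  | cons b β ih =>
    have hpos : ∀ x ∈ β, 0 < x := fun x hx => hβpos x (List.mem_cons_of_mem _ hx)
    have hlast : ∀ h : β ≠ [], 2 ≤ β.getLast h := fun h => by
      simpa [List.getLast_cons h] using hβ (List.cons_ne_nil b β)
    rw [toReal_chainSum_le_cons b β (chainSum_le_ne_top β hpos hlast)
      (chainSum_le_ne_top _ hβpos hβ 1), List.length_cons, Finset.sum_range_succ']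
    simp only [← ih hpos hlast, List.drop_succ_cons, List.take_succ_cons, List.drop_zero,
      List.take_zero, chainSum_nil]
    simp only [toReal_chainSum_gt_cons b _ fun x hx => hpos x (List.mem_of_mem_take hx),
      Finset.mul_sum]
    rw [Finset.sum_comm (s := Finset.Iio n), sub_eq_neg_add, ← Finset.sum_neg_distrib]
    simp only [← Finset.sum_neg_distrib, pow_zero, one_mul, ENNReal.toReal_one, mul_one]
    congr 1
    refine Finset.sum_congr rfl fun k _ => Finset.sum_congr rfl fun j _ => ?_
    ring

/-- Reversal of a tuple indexed by the positions of a reversed list. -/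
def reverseTuple (l : List ℕ) : (Fin l.length → ℕ+) ≃ (Fin l.reverse.length → ℕ+) :=
  Equiv.arrowCongr (Fin.revPerm.trans (finCongr l.length_reverse.symm)) (Equiv.refl _)

lemma reverseTuple_apply (l : List ℕ) (f : Fin l.length → ℕ+) (i : Fin l.reverse.length) :
    reverseTuple l f i = f (Fin.rev (i.cast l.length_reverse)) := rfl

lemma strictMono_reverseTuple (l : List ℕ) (f : Fin l.length → ℕ+) :
    StrictMono (reverseTuple l f) ↔ StrictAnti f := by
  constructor
  · intro h i j hij
    simpa [reverseTuple_apply] using h (a := (Fin.rev j).cast l.length_reverse.symm)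
      (b := (Fin.rev i).cast l.length_reverse.symm) (by simpa using hij)
  · intro h i j hij
    exact h (Fin.rev_lt_rev.2 (by simpa using hij))

lemma monotone_reverseTuple (l : List ℕ) (f : Fin l.length → ℕ+) :
    Monotone (reverseTuple l f) ↔ Antitone f := by
  constructor
  · intro h i j hij
    simpa [reverseTuple_apply] using h (a := (Fin.rev j).cast l.length_reverse.symm)
      (b := (Fin.rev i).cast l.length_reverse.symm) (by simpa using hij)
  · intro h i j hij
    exact h (Fin.rev_le_rev.2 (by simpa using hij))

lemma prod_reverseTuple (l : List ℕ) (f : Fin l.length → ℕ+) :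
    ∏ i : Fin l.reverse.length, ((reverseTuple l f i : ℝ) ^ (l.reverse.get i))⁻¹ =
      ∏ i : Fin l.length, ((f i : ℝ) ^ (l.get i))⁻¹ := by
  refine Fintype.prod_equiv ((finCongr l.length_reverse).trans Fin.revPerm) _ _ fun i => ?_
  simp only [reverseTuple_apply, Equiv.trans_apply, finCongr_apply, Fin.revPerm_apply]
  congr 2
  simp only [List.get_eq_getElem, List.getElem_reverse, Fin.val_rev, Fin.val_cast]
  congr 1
  omega

open Classical in
lemma tsum_chainSum_mul_chainSum (θ : ℕ) (l ρ : List ℕ) :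
    ∑' n : ℕ+, zetaWeight θ n * chainSum (· > ·) l n * chainSum (· ≥ ·) ρ n =
      ∑' p : (Fin (θ :: l).length → ℕ+) × (Fin ρ.length → ℕ+),
        if StrictAnti p.1 ∧ Antitone p.2 ∧ ∀ j, p.2 j ≤ p.1 0 then
          (∏ i, zetaWeight ((θ :: l).get i) (p.1 i)) * ∏ j, zetaWeight (ρ.get j) (p.2 j)
        else 0 := by
  rw [ENNReal.tsum_prod']
  refine ((tsum_fin_cons (n := l.length) _).trans (tsum_congr fun n => ?_)).symm
  simp only [chainSum, ← ENNReal.tsum_mul_left, ← ENNReal.tsum_mul_right]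
  refine (tsum_congr fun f => tsum_congr fun g => ?_).trans ENNReal.tsum_comm
  have hcond : (StrictAnti (Fin.cons n f : Fin (l.length + 1) → ℕ+) ∧ Antitone g ∧
      ∀ j, g j ≤ n) ↔ ((∀ i, n > f i) ∧ ∀ i j, i < j → f i > f j) ∧
        (∀ j, n ≥ g j) ∧ ∀ i j, i < j → g i ≥ g j := by
    constructor
    · rintro ⟨h1, h2, h3⟩
      exact ⟨⟨fun i => h1 (Fin.succ_pos i),
        fun i j hij => h1 (Fin.succ_lt_succ_iff.2 hij)⟩, h3, fun i j hij => h2 hij.le⟩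
    · rintro ⟨⟨h1, h2⟩, h3, h4⟩
      refine ⟨fun i j hij => ?_, antitone_iff_forall_lt.2 fun i j hij => h4 i j hij, h3⟩
      induction j using Fin.cases with
      | zero => exact absurd hij (Fin.not_lt_zero i)
      | succ j =>
        induction i using Fin.cases with
        | zero => exact h1 j
        | succ i => exact h2 i j (Fin.succ_lt_succ_iff.1 hij)
  refine (if_congr hcond (congrArg (· * _) (Fin.prod_univ_succ (n := l.length) _)) rfl).trans ?_
  by_cases hf : (∀ i, n > f i) ∧ ∀ i j, i < j → f i > f j
  · by_cases hg : (∀ j, n ≥ g j) ∧ ∀ i j, i < j → g i ≥ g j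
    · rw [if_pos ⟨hf, hg⟩, if_pos hf, if_pos hg]
      rfl
    · rw [if_neg fun h => hg h.2, if_neg hg, mul_zero]
  · rw [if_neg fun h => hf h.1, if_neg hf, mul_zero, zero_mul]

lemma ZU_reverse_cons (θ : ℕ) (l ρ : List ℕ) :
    ZU (θ :: l).reverse ρ.reverse =
      (∑' n : ℕ+, zetaWeight θ n * chainSum (· > ·) l n * chainSum (· ≥ ·) ρ n).toReal := by
  classical
  rw [tsum_chainSum_mul_chainSum, ENNReal.tsum_toReal_eq]
  · unfold ZU
    refine (tsum_subtype_eq_tsum_ite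
      (fun p : (Fin (θ :: l).reverse.length → ℕ+) × (Fin ρ.reverse.length → ℕ+) =>
        StrictMono p.1 ∧ Monotone p.2 ∧
        ∀ j : Fin ρ.reverse.length, (j : ℕ) = ρ.reverse.length - 1 →
          ∀ i : Fin (θ :: l).reverse.length, (i : ℕ) = (θ :: l).reverse.length - 1 →
            p.2 j ≤ p.1 i)
      (fun p => (∏ i, ((p.1 i : ℝ) ^ ((θ :: l).reverse.get i))⁻¹) *
        ∏ j, ((p.2 j : ℝ) ^ (ρ.reverse.get j))⁻¹)).trans ?_
    rw [← ((reverseTuple (θ :: l)).prodCongr (reverseTuple ρ)).tsum_eq]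
    refine tsum_congr fun ⟨f, g⟩ => ?_
    rw [apply_ite ENNReal.toReal, ENNReal.toReal_mul, ENNReal.toReal_prod,
      ENNReal.toReal_prod]
    simp only [toReal_zetaWeight, ENNReal.toReal_zero, Equiv.prodCongr_apply, Prod.map_apply,
      prod_reverseTuple]
    refine if_congr ?_ rfl rfl
    rw [strictMono_reverseTuple, monotone_reverseTuple]
    refine and_congr_right fun _ => and_congr_right fun hg => ?_
    simp only [reverseTuple_apply]
    constructor
    · intro h j
      have hρ : 0 < ρ.length := j.pos
      have := h ⟨ρ.length - 1, by simp; omega⟩ (by simp) ⟨l.length, by simp⟩ (by simp)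
      refine (hg (show (⟨0, hρ⟩ : Fin ρ.length) ≤ j from Nat.zero_le _)).trans ?_
      convert this using 2
      · ext; simp; omega
      · ext; simp
    · intro h j hj i hi
      convert h _ using 2
      ext; simp at hi; simp [hi]
  · intro p
    split_ifs
    · exact ENNReal.mul_ne_top (ENNReal.prod_ne_top fun i _ => zetaWeight_ne_top _ _)
        (ENNReal.prod_ne_top fun i _ => zetaWeight_ne_top _ _)
    · simp

/-- Proposition 3.1, Eq. (3.3). -/
theorem stmt_11 (θ : ℕ) (hθ : 2 ≤ θ) (α β : List ℕ)
    (hαpos : ∀ x ∈ α, 0 < x) (hβpos : ∀ x ∈ β, 0 < x)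
    (hβ : ∀ h : β ≠ [], 2 ≤ β.getLast h) :
    ∑ k ∈ Finset.range (β.length + 1),
      (-1 : ℝ) ^ k * mzvStar (β.drop k) * ZU ((β.take k).reverse ++ [θ]) α
    = mzvStar (α ++ θ :: β) := by
  obtain ⟨ρ, rfl⟩ : ∃ ρ : List ℕ, α = ρ.reverse := ⟨α.reverse, α.reverse_reverse.symm⟩
  have hρ : ∀ x ∈ ρ, 0 < x := fun x hx => hαpos x (List.mem_reverse.2 hx)
  have htake : ∀ k, ∀ x ∈ β.take k, 0 < x := fun k x hx => hβpos x (List.mem_of_mem_take hx)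
  have hne : ∀ k, ∀ n : ℕ+,
      zetaWeight θ n * chainSum (· > ·) (β.take k) n * chainSum (· ≥ ·) ρ n ≠ ⊤ := fun k n =>
    ENNReal.mul_ne_top (ENNReal.mul_ne_top (zetaWeight_ne_top _ _)
      (chainSum_gt_ne_top _ (htake k) n)) (chainSum_ge_ne_top ρ hρ n)
  have hZU : ∀ k, ZU ((β.take k).reverse ++ [θ]) ρ.reverse = ∑' n : ℕ+,
      (zetaWeight θ n * chainSum (· > ·) (β.take k) n * chainSum (· ≥ ·) ρ n).toReal := by
    intro k
    rw [← List.reverse_cons, ZU_reverse_cons, ENNReal.tsum_toReal_eq (hne k)]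
  have hsummable : ∀ k, Summable fun n : ℕ+ =>
      (zetaWeight θ n * chainSum (· > ·) (β.take k) n * chainSum (· ≥ ·) ρ n).toReal := fun k =>
    ENNReal.summable_toReal (tsum_zetaWeight_mul_ne_top hθ hρ (htake k))
  simp only [hZU, mzvStar_eq_toReal, ← tsum_mul_left]
  rw [← Summable.tsum_finsetSum fun k _ => (hsummable k).mul_left _, chainSum_reverse_append,
    ENNReal.tsum_toReal_eq fun n => ENNReal.mul_ne_top (ENNReal.mul_ne_top (zetaWeight_ne_top _ _)
      (chainSum_ge_ne_top ρ hρ n)) (chainSum_le_ne_top β hβpos hβ n)]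
  refine tsum_congr fun n => ?_
  simp only [ENNReal.toReal_mul]
  rw [← sum_neg_one_pow_chainSum β hβpos hβ n, Finset.mul_sum]
  refine Finset.sum_congr rfl fun k _ => ?_
  ring
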